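/- (Limit set of a bounded perturbed solution.) Let F : ℝ^m → (sets of ℝ^m) be a set-valued map with closed graph, nonempty compact convex values, and linear growth (there exists c > 0 such that sup_{z ∈ F(x)} ‖z‖ ≤ c(1 + ‖x‖) for all x). Suppose V : ℝ^m → [0,∞) is a Lyapunov function for the differential inclusion dx/dt ∈ F(x). Then every bounded perturbed solution y : [0,∞) → ℝ^m of dx/dt ∈ F(x) satisfies ⋂_{t≥0} closure{y(τ) : τ ≥ t} ⊆ {x ∈ ℝ^m : V(x) = 0}. -/

import Mathlib

open Filter Topology MeasureTheory

variable {m : ℕ}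

/-- a solution of the differential inclusion `dx/dt ∈ F(x)` on `[0,∞)` -/
def IsSolutionDI (F : EuclideanSpace ℝ (Fin m) → Set (EuclideanSpace ℝ (Fin m)))
    (x : ℝ → EuclideanSpace ℝ (Fin m)) : Prop :=
  ∃ v : ℝ → EuclideanSpace ℝ (Fin m),
    (∀ T : ℝ, IntegrableOn v (Set.Icc 0 T)) ∧
    (∀ t : ℝ, 0 ≤ t → x t = x 0 + ∫ τ in (0:ℝ)..t, v τ) ∧
    (∀ᵐ τ ∂(volume.restrict (Set.Ici (0:ℝ))), v τ ∈ F (x τ))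

/-- the `δ`-thickening `F^δ` of a set-valued map `F` -/
def FDel (F : EuclideanSpace ℝ (Fin m) → Set (EuclideanSpace ℝ (Fin m))) (δ : ℝ)
    (x : EuclideanSpace ℝ (Fin m)) : Set (EuclideanSpace ℝ (Fin m)) :=
  {w | ∃ z, ‖z - x‖ < δ ∧ ∃ u ∈ F z, ‖w - u‖ < δ}

/-- a perturbed solution of the differential inclusion `dx/dt ∈ F(x)` on `[0,∞)` -/
def IsPerturbedSolutionDI (F : EuclideanSpace ℝ (Fin m) → Set (EuclideanSpace ℝ (Fin m)))
    (y : ℝ → EuclideanSpace ℝ (Fin m)) : Prop :=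
  ∃ u : ℝ → EuclideanSpace ℝ (Fin m), ∃ δ : ℝ → ℝ,
    (∀ T : ℝ, IntegrableOn u (Set.Icc 0 T)) ∧
    (∀ t : ℝ, 0 ≤ t → y t = y 0 + ∫ τ in (0:ℝ)..t, u τ) ∧
    (∀ t, 0 < δ t) ∧ Tendsto δ atTop (𝓝 0) ∧
    (∀ᵐ τ ∂(volume.restrict (Set.Ici (0:ℝ))), u τ ∈ FDel F (δ τ) (y τ))

open Set

/-- The fundamental theorem of calculus for Lipschitz functions with values in a
finite-dimensional space. -/
theorem LipschitzWith.locallyIntegrable_deriv_and_integral_deriv_eq_sub {E : Type*}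
    [NormedAddCommGroup E] [NormedSpace ℝ E] [FiniteDimensional ℝ E] {K : NNReal} {f : ℝ → E}
    (hf : LipschitzWith K f) (a b : ℝ) :
    LocallyIntegrable (deriv f) ∧ ∫ t in a..b, deriv f t = f b - f a := by
  have : CompleteSpace E := FiniteDimensional.complete ℝ E
  have hloc : LocallyIntegrable (deriv f) :=
    (locallyIntegrable_const (K : ℝ)).mono (aestronglyMeasurable_deriv f _) <|
      ae_of_all _ fun t => by
        simpa using norm_deriv_le_of_lipschitz (x₀ := t) hf
  have hint (c d : ℝ) : IntervalIntegrable (deriv f) volume c d :=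
    intervalIntegrable_iff.2 <|
      (hloc.integrableOn_isCompact isCompact_uIcc).mono_set uIoc_subset_uIcc
  refine ⟨hloc, ?_⟩
  have hprim : LipschitzWith K fun x => ∫ t in a..x, deriv f t := by
    refine LipschitzWith.of_dist_le_mul fun c d => ?_
    rw [dist_eq_norm, intervalIntegral.integral_interval_sub_left (hint a c) (hint a d),
      Real.dist_eq]
    exact intervalIntegral.norm_integral_le_of_norm_le_const
      fun t _ => norm_deriv_le_of_lipschitz hf
  have hlip : LipschitzWith (K + K) fun x => f x - ∫ t in a..x, deriv f t := hf.sub hprim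
  obtain ⟨C, hC⟩ := (hlip.lipschitzOnWith
    (s := uIcc a b)).absolutelyContinuousOnInterval.const_of_ae_hasDerivAt_zero (by
      filter_upwards [hf.ae_differentiableAt_real,
        LocallyIntegrable.ae_hasDerivAt_integral hloc] with x hx₁ hx₂ _
      have h := hx₁.hasDerivAt.sub (hx₂ a)
      rw [sub_self] at h
      exact h)
  have h₁ := hC a left_mem_uIcc
  have h₂ := hC b right_mem_uIcc
  simp only [intervalIntegral.integral_same, sub_zero] at h₁
  rw [h₁, ← h₂]
  abel

/-- The slope of a primitive is the average of its derivative. -/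
theorem slope_eq_setAverage_of_eq_integral {E : Type*} [NormedAddCommGroup E] [NormedSpace ℝ E]
    {y u : ℝ → E} (hu : ∀ T : ℝ, IntegrableOn u (Icc 0 T))
    (hy : ∀ t : ℝ, 0 ≤ t → y t = y 0 + ∫ τ in (0 : ℝ)..t, u τ) {a b : ℝ} (ha : 0 ≤ a)
    (hab : a ≤ b) :
    IntegrableOn u (Ioc a b) ∧ y b - y a = ∫ τ in a..b, u τ ∧
      slope y a b = ⨍ τ in Ioc a b, u τ := by
  have hint (c d : ℝ) (hc : 0 ≤ c) (hcd : c ≤ d) : IntervalIntegrable u volume c d := by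
    rw [intervalIntegrable_iff_integrableOn_Ioc_of_le hcd]
    exact (hu d).mono_set (Ioc_subset_Icc_self.trans (Icc_subset_Icc_left hc))
  have hsub : y b - y a = ∫ τ in a..b, u τ := by
    rw [hy b (ha.trans hab), hy a ha, add_sub_add_left_eq_sub,
      intervalIntegral.integral_interval_sub_left (hint 0 b le_rfl (ha.trans hab))
        (hint 0 a le_rfl ha)]
  refine ⟨(hint a b ha hab).1, hsub, ?_⟩
  rw [slope_def_module, hsub, setAverage_eq, intervalIntegral.integral_of_le hab,
    Real.volume_real_Ioc_of_le hab]

/-- A set-valued map with closed graph, locally bounded, is upper semicontinuous, uniformly under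
small perturbations. -/
theorem exists_FDel_subset_cthickening
    {F : EuclideanSpace ℝ (Fin m) → Set (EuclideanSpace ℝ (Fin m))}
    (hgraph : IsClosed {q : EuclideanSpace ℝ (Fin m) × EuclideanSpace ℝ (Fin m) | q.2 ∈ F q.1})
    {c : ℝ} (hc : 0 < c) (hgrowth : ∀ x, ∀ z ∈ F x, ‖z‖ ≤ c * (1 + ‖x‖))
    (x₀ : EuclideanSpace ℝ (Fin m)) {ε : ℝ} (hε : 0 < ε) :
    ∃ η > 0, ∀ δ ≤ η, ∀ z, ‖z - x₀‖ < η → FDel F δ z ⊆ Metric.cthickening ε (F x₀) := by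
  set K := Metric.closedBall (0 : EuclideanSpace ℝ (Fin m)) (c * (2 + ‖x₀‖)) \
    Metric.thickening (ε / 2) (F x₀)
  have hK : IsCompact K := (isCompact_closedBall _ _).diff Metric.isOpen_thickening
  obtain ⟨s, t, hs, -, hxs, hKt, hst⟩ := generalized_tube_lemma (isCompact_singleton (x := x₀)) hK
    hgraph.isOpen_compl (by
      rintro ⟨p, w⟩ ⟨rfl, hw⟩ hmem
      exact hw.2 (Metric.self_subset_thickening (by positivity) _ hmem))
  obtain ⟨r, hr, hball⟩ := Metric.isOpen_iff.1 hs x₀ (hxs rfl)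
  have husc : ∀ z, ‖z - x₀‖ < min r 1 → F z ⊆ Metric.thickening (ε / 2) (F x₀) := by
    intro z hz w hw
    by_contra hw'
    have hz1 : ‖z‖ ≤ 1 + ‖x₀‖ := by
      have := norm_le_norm_add_norm_sub' z x₀
      linarith [hz.trans_le (min_le_right _ _)]
    refine hst (mk_mem_prod (hball ?_) (hKt ⟨?_, hw'⟩)) hw
    · rw [mem_ball_iff_norm]
      exact hz.trans_le (min_le_left _ _)
    · rw [mem_closedBall_zero_iff]
      refine (hgrowth z w hw).trans ?_
      linarith [mul_le_mul_of_nonneg_left hz1 hc.le]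
  have hmin : 0 < min r 1 := lt_min hr one_pos
  refine ⟨min (min r 1 / 2) (ε / 2), by positivity, fun δ hδ z hz w ⟨z', hz', v, hv, hw⟩ => ?_⟩
  have h₁ := min_le_left (min r 1 / 2) (ε / 2)
  have h₂ := min_le_right (min r 1 / 2) (ε / 2)
  obtain ⟨v', hv', hvv'⟩ := Metric.mem_thickening_iff.1 <| husc z' (by
    have := norm_sub_le_norm_sub_add_norm_sub z' z x₀
    linarith) hv
  refine Metric.mem_cthickening_of_dist_le w v' ε _ hv' ?_
  rw [← dist_eq_norm] at hw
  linarith [dist_triangle w v v']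

/-- A bounded perturbed solution is eventually Lipschitz. -/
theorem IsPerturbedSolutionDI.exists_lipschitzOnWith
    {F : EuclideanSpace ℝ (Fin m) → Set (EuclideanSpace ℝ (Fin m))} {c : ℝ} (hc : 0 < c)
    (hgrowth : ∀ x, ∀ z ∈ F x, ‖z‖ ≤ c * (1 + ‖x‖)) {y : ℝ → EuclideanSpace ℝ (Fin m)}
    (hy : IsPerturbedSolutionDI F y) (hybdd : Bornology.IsBounded (range y)) :
    ∃ K : NNReal, ∃ T : ℝ, LipschitzOnWith K y (Ici T) := by
  obtain ⟨u, δ, hu, hyu, -, hδ, huF⟩ := hy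
  obtain ⟨R, hR, hyR⟩ := hybdd.exists_pos_norm_le
  obtain ⟨T, hT⟩ := eventually_atTop.1 (hδ.eventually_le_const zero_lt_one)
  set K : ℝ := c * (2 + R) + 1
  have hK : 0 ≤ K := by positivity
  refine ⟨⟨K, hK⟩, max T 0, LipschitzOnWith.of_dist_le_mul fun a ha b hb => ?_⟩
  wlog hba : b ≤ a generalizing a b
  · rw [dist_comm, dist_comm a]
    exact this b hb a ha (le_of_not_ge hba)
  have hb0 : 0 ≤ b := (le_max_right _ _).trans hb
  rw [dist_eq_norm, (slope_eq_setAverage_of_eq_integral hu hyu hb0 hba).2.1, Real.dist_eq]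
  refine intervalIntegral.norm_integral_le_of_norm_le_const_ae (C := K) ?_
  filter_upwards [(ae_restrict_iff' measurableSet_Ici).1 huF] with τ hτ hτab
  rw [uIoc_of_le hba] at hτab
  obtain ⟨z, hz, v, hv, huv⟩ := hτ (hb0.trans hτab.1.le)
  have hδτ : δ τ ≤ 1 := hT τ ((le_max_left _ _).trans (le_trans hb hτab.1.le))
  have hz1 : ‖z‖ ≤ 1 + R := by
    have := norm_le_norm_add_norm_sub' z (y τ)
    linarith [hyR (y τ) (mem_range_self τ)]
  have hv1 : ‖v‖ ≤ c * (2 + R) :=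
    (hgrowth z v hv).trans (by linarith [mul_le_mul_of_nonneg_left hz1 hc.le])
  have := norm_le_norm_add_norm_sub' (u τ) v
  linarith

/-- Late slopes of a perturbed solution near `x₀` are close to `F x₀`. -/
theorem IsPerturbedSolutionDI.exists_slope_mem_cthickening
    {F : EuclideanSpace ℝ (Fin m) → Set (EuclideanSpace ℝ (Fin m))}
    (hgraph : IsClosed {q : EuclideanSpace ℝ (Fin m) × EuclideanSpace ℝ (Fin m) | q.2 ∈ F q.1})
    (hconv : ∀ x, Convex ℝ (F x)) {c : ℝ} (hc : 0 < c)
    (hgrowth : ∀ x, ∀ z ∈ F x, ‖z‖ ≤ c * (1 + ‖x‖)) {y : ℝ → EuclideanSpace ℝ (Fin m)}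
    (hy : IsPerturbedSolutionDI F y) (x₀ : EuclideanSpace ℝ (Fin m)) {ε : ℝ} (hε : 0 < ε) :
    ∃ η > 0, ∃ T, ∀ a b, T ≤ a → a < b → (∀ s ∈ Icc a b, ‖y s - x₀‖ < η) →
      slope y a b ∈ Metric.cthickening ε (F x₀) := by
  obtain ⟨u, δ, hu, hyu, -, hδ, huF⟩ := hy
  obtain ⟨η, hη, hsub⟩ := exists_FDel_subset_cthickening hgraph hc hgrowth x₀ hε
  obtain ⟨T, hT⟩ := eventually_atTop.1 (hδ.eventually_le_const hη)
  refine ⟨η, hη, max T 0, fun a b ha hab hys => ?_⟩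
  have ha0 : 0 ≤ a := (le_max_right _ _).trans ha
  obtain ⟨hint, -, hslope⟩ := slope_eq_setAverage_of_eq_integral hu hyu ha0 hab.le
  rw [hslope]
  refine ((hconv x₀).cthickening ε).set_average_mem Metric.isClosed_cthickening
    (by simpa using hab) (by simp) ?_ hint
  rw [ae_restrict_iff' measurableSet_Ioc]
  filter_upwards [(ae_restrict_iff' measurableSet_Ici).1 huF] with τ hτ hτab
  exact hsub (δ τ) (hT τ ((le_max_left _ _).trans (ha.trans hτab.1.le))) (y τ)
    (hys τ (Ioc_subset_Icc_self hτab)) (hτ (ha0.trans hτab.1.le))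

/-- Limits of the time translates of a bounded perturbed solution are solutions. -/
theorem IsPerturbedSolutionDI.isSolutionDI_of_tendsto
    {F : EuclideanSpace ℝ (Fin m) → Set (EuclideanSpace ℝ (Fin m))}
    (hgraph : IsClosed {q : EuclideanSpace ℝ (Fin m) × EuclideanSpace ℝ (Fin m) | q.2 ∈ F q.1})
    (hcpt : ∀ x, IsCompact (F x)) (hconv : ∀ x, Convex ℝ (F x)) {c : ℝ} (hc : 0 < c)
    (hgrowth : ∀ x, ∀ z ∈ F x, ‖z‖ ≤ c * (1 + ‖x‖)) {y : ℝ → EuclideanSpace ℝ (Fin m)}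
    (hy : IsPerturbedSolutionDI F y) (hybdd : Bornology.IsBounded (range y))
    {l : Filter ℝ} [l.NeBot] (hl : l ≤ atTop) {x : ℝ → EuclideanSpace ℝ (Fin m)}
    (hx : ∀ t, Tendsto (fun s => y (s + t)) l (𝓝 (x t))) : IsSolutionDI F x := by
  obtain ⟨K, T, hK⟩ := hy.exists_lipschitzOnWith hc hgrowth hybdd
  have hge (t A : ℝ) : ∀ᶠ s in l, A ≤ s + t :=
    (tendsto_atTop_add_const_right l t (tendsto_id.mono_left hl)).eventually_ge_atTop A
  have hxlip : LipschitzWith K x := by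
    refine LipschitzWith.of_dist_le_mul fun a b => ?_
    refine le_of_tendsto ((hx a).dist (hx b)) ?_
    filter_upwards [hge a T, hge b T] with s ha hb
    simpa using hK.dist_le_mul _ ha _ hb
  have hderiv : ∀ t v, HasDerivAt x v t → v ∈ F (x t) := by
    intro t v hv
    rw [← (hcpt (x t)).isClosed.closure_eq, Metric.closure_eq_iInter_cthickening]
    refine mem_iInter₂.2 fun ε hε => ?_
    obtain ⟨η, hη, T', hT'⟩ :=
      hy.exists_slope_mem_cthickening hgraph hconv hc hgrowth (x t) hε
    have hslope : Tendsto (slope x t) (𝓝[>] t) (𝓝 v) :=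
      (hasDerivAt_iff_tendsto_slope_left_right.1 hv).2
    refine Metric.isClosed_cthickening.mem_of_tendsto hslope ?_
    have hsmall : ∀ᶠ b in 𝓝[>] t, K * (b - t) < η / 2 := by
      refine Filter.Eventually.filter_mono nhdsWithin_le_nhds ?_
      have : Tendsto (fun b => K * (b - t)) (𝓝 t) (𝓝 (K * (t - t))) :=
        Continuous.tendsto (by fun_prop) t
      rw [sub_self, mul_zero] at this
      exact this.eventually_lt_const (by positivity)
    filter_upwards [hsmall, self_mem_nhdsWithin] with b hb htb
    rw [mem_Ioi] at htb
    have hlim : Tendsto (fun s => slope y (s + t) (s + b)) l (𝓝 (slope x t b)) := by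
      simp only [slope_def_module, add_sub_add_left_eq_sub]
      exact ((hx b).sub (hx t)).const_smul _
    refine Metric.isClosed_cthickening.mem_of_tendsto hlim ?_
    filter_upwards [hge t T, hge t T', (hx t).eventually (Metric.ball_mem_nhds _ (half_pos hη))]
      with s hs hs' hsx
    refine hT' _ _ hs' (by linarith) fun r hr => ?_
    rw [← dist_eq_norm]
    have h₁ := hK.dist_le_mul r (hs.trans hr.1) (s + t) hs
    have h₂ : K * dist r (s + t) ≤ K * (b - t) := by
      rw [Real.dist_eq, abs_of_nonneg (by linarith [hr.1])]
      exact mul_le_mul_of_nonneg_left (by linarith [hr.2]) K.coe_nonneg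
    linarith [dist_triangle (y r) (y (s + t)) (x t), Metric.mem_ball.1 hsx]
  have hftc := hxlip.locallyIntegrable_deriv_and_integral_deriv_eq_sub 0
  refine ⟨deriv x, fun _ => (hftc 0).1.integrableOn_isCompact isCompact_Icc, fun t _ => ?_,
    ae_restrict_of_ae ?_⟩
  · rw [(hftc t).2]
    abel
  · filter_upwards [hxlip.ae_differentiableAt_real] with t ht
    exact hderiv t _ ht.hasDerivAt

/-- Limit-set theorem (Benaïm–Hofbauer–Sorin): if `V` is a Lyapunov function for the
differential inclusion `dx/dt ∈ F(x)`, where `F` has closed graph, nonempty compact convex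
values and linear growth, then the limit set of any bounded perturbed solution is
contained in `{V = 0}`. -/
theorem limit_set_of_perturbed_solution
    (F : EuclideanSpace ℝ (Fin m) → Set (EuclideanSpace ℝ (Fin m)))
    (hgraph : IsClosed {q : EuclideanSpace ℝ (Fin m) × EuclideanSpace ℝ (Fin m) | q.2 ∈ F q.1})
    (hne : ∀ x, (F x).Nonempty) (hcpt : ∀ x, IsCompact (F x)) (hconv : ∀ x, Convex ℝ (F x))
    (hgrowth : ∃ c : ℝ, 0 < c ∧ ∀ x, ∀ z ∈ F x, ‖z‖ ≤ c * (1 + ‖x‖))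
    (V : EuclideanSpace ℝ (Fin m) → ℝ)
    (hVcont : Continuous V) (hVnonneg : ∀ x, 0 ≤ V x)
    (hLyap : ∀ x : ℝ → EuclideanSpace ℝ (Fin m), IsSolutionDI F x →
      ∀ t t' : ℝ, 0 ≤ t → t < t' →
        V (x t') ≤ V (x t) ∧ (V (x t') = V (x t) ↔ V (x t) = 0))
    (y : ℝ → EuclideanSpace ℝ (Fin m)) (hy : IsPerturbedSolutionDI F y)
    (hybdd : Bornology.IsBounded (Set.range y)) :
    ⋂ t ∈ Set.Ici (0:ℝ), closure (y '' Set.Ici t) ⊆ {x | V x = 0} := by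
  obtain ⟨c, hc, hgrowth⟩ := hgrowth
  have hL : ∀ p, p ∈ ⋂ t ∈ Ici (0 : ℝ), closure (y '' Ici t) ↔ MapClusterPt p atTop y := by
    intro p
    rw [mapClusterPt_atTop_iff_forall_mem_closure, mem_iInter₂]
    exact ⟨fun h i => closure_mono (image_mono (Ici_subset_Ici.2 (le_max_left i 0)))
      (h _ (le_max_right i 0)), fun h i _ => h i⟩
  set L := ⋂ t ∈ Ici (0 : ℝ), closure (y '' Ici t)
  have hcl : IsCompact (closure (range y)) := hybdd.isCompact_closure
  have hLcpt : IsCompact L := hcl.of_isClosed_subset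
    (isClosed_biInter fun _ _ => isClosed_closure)
    ((biInter_subset_of_mem self_mem_Ici).trans (closure_mono (image_subset_range _ _)))
  intro q hq
  obtain ⟨p, hpL, hpmax⟩ := hLcpt.exists_isMaxOn ⟨q, hq⟩ hVcont.continuousOn
  obtain ⟨U, hU, hUp⟩ := mapClusterPt_iff_ultrafilter.1 ((hL p).1 hpL)
  have hlim : ∀ t : ℝ, ∃ a, Tendsto (fun s => y (s + (t - 1))) U (𝓝 a) := fun t => by
    obtain ⟨a, -, ha⟩ := hcl.ultrafilter_le_nhds (U.map fun s => y (s + (t - 1)))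
      (le_principal_iff.2 (Filter.mem_map.2 (Filter.univ_mem'
        fun s => subset_closure (mem_range_self _))))
    exact ⟨a, ha⟩
  choose x hx using hlim
  have hxL : ∀ t, x t ∈ L := fun t => (hL _).2 <| ((hx t).mapClusterPt).of_comp
    (tendsto_atTop_add_const_right _ (t - 1) (tendsto_id.mono_left hU))
  have hx1 : x 1 = p := tendsto_nhds_unique (by simpa using hx 1) hUp
  have hshift : Tendsto (fun s : ℝ => s + (-1)) U atTop :=
    tendsto_atTop_add_const_right _ _ (tendsto_id.mono_left hU)
  have hsol : IsSolutionDI F x :=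
    hy.isSolutionDI_of_tendsto hgraph hcpt hconv hc hgrowth hybdd hshift fun t =>
      tendsto_map'_iff.2 <| (hx t).congr fun s => by
        simp only [Function.comp_apply]
        congr 1
        ring
  obtain ⟨hle, heq⟩ := hLyap x hsol 0 1 le_rfl one_pos
  have h0 : V (x 0) ≤ V p := hpmax (hxL 0)
  rw [hx1] at hle heq
  have hzero := heq.1 (le_antisymm hle h0)
  have hqp : V q ≤ V p := hpmax hq
  exact le_antisymm (by linarith) (hVnonneg q)
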